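/- Let e_1 = (1,0) and e_2 = (0,1) in (F_2)^2, where F_2 is the field with two elements. There do not exist vectors m_3, m_4 ∈ (F_2)^2 such that e_2 ∈ span{e_1, m_3}, e_1 ∈ span{e_2, m_3}, e_2 ∈ span{e_1, m_4}, e_1 ∈ span{e_2, m_4}, e_1 ∈ span{m_3, m_4}, and e_2 ∈ span{m_3, m_4}. (This is precisely the statement that the network constructed in the paper from the discrete polymatroid of Example 1 — with two messages x_1, x_2, two coded edges carrying linear combinations m_3, m_4 of the messages, and sinks decoding x_2 from (x_1, edge 3), x_1 from (x_2, edge 3), x_2 from (x_1, edge 4), x_1 from (x_2, edge 4), and x_1 and x_2 from (edge 3, edge 4) — admits no scalar linear solution over F_2.) -/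

import Mathlib

/-- Over `F₂`, a coded vector from which each message can be decoded given the other one
is the sum of the two messages. -/
theorem eq_one_of_mem_span_pair {m : Fin 2 → ZMod 2}
    (h₂ : ![(0 : ZMod 2), 1] ∈ Submodule.span (ZMod 2) {![(1 : ZMod 2), 0], m})
    (h₁ : ![(1 : ZMod 2), 0] ∈ Submodule.span (ZMod 2) {![(0 : ZMod 2), 1], m}) :
    m = 1 := by
  have eq_one_of_mul : ∀ b c : ZMod 2, b * c = 1 → c = 1 := by decide
  obtain ⟨a, b, hab⟩ := Submodule.mem_span_pair.mp h₂
  obtain ⟨c, d, hcd⟩ := Submodule.mem_span_pair.mp h₁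
  ext i
  fin_cases i
  · exact eq_one_of_mul d _ (by simpa using congrFun hcd 0)
  · exact eq_one_of_mul b _ (by simpa using congrFun hab 1)

/-- **The network of Fig. 4 has no scalar linear solution over `F₂` (Lemma 1).**
With messages having global encoding vectors `e₁ = (1,0)` and `e₂ = (0,1)` in `(F₂)²`,
there are no global encoding vectors `m₃, m₄ ∈ (F₂)²` for the two coded edges allowing
every sink to decode its demand: `x₂` from `(e₁, m₃)`, `x₁` from `(e₂, m₃)`,
`x₂` from `(e₁, m₄)`, `x₁` from `(e₂, m₄)`, and both `x₁, x₂` from `(m₃, m₄)`. -/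
theorem no_scalar_linear_solution_over_F2 :
    ¬ ∃ m₃ m₄ : Fin 2 → ZMod 2,
      ![(0 : ZMod 2), 1] ∈ Submodule.span (ZMod 2) {![(1 : ZMod 2), 0], m₃} ∧
      ![(1 : ZMod 2), 0] ∈ Submodule.span (ZMod 2) {![(0 : ZMod 2), 1], m₃} ∧
      ![(0 : ZMod 2), 1] ∈ Submodule.span (ZMod 2) {![(1 : ZMod 2), 0], m₄} ∧
      ![(1 : ZMod 2), 0] ∈ Submodule.span (ZMod 2) {![(0 : ZMod 2), 1], m₄} ∧
      ![(1 : ZMod 2), 0] ∈ Submodule.span (ZMod 2) {m₃, m₄} ∧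
      ![(0 : ZMod 2), 1] ∈ Submodule.span (ZMod 2) {m₃, m₄} := by
  rintro ⟨m₃, m₄, h₃₂, h₃₁, h₄₂, h₄₁, h, -⟩
  obtain rfl := eq_one_of_mem_span_pair h₃₂ h₃₁
  obtain rfl := eq_one_of_mem_span_pair h₄₂ h₄₁
  obtain ⟨a, b, hab⟩ := Submodule.mem_span_pair.mp h
  have h₀ : a + b = 1 := by simpa using congrFun hab 0
  have h₁ : a + b = 0 := by simpa using congrFun hab 1
  exact one_ne_zero (h₀.symm.trans h₁)
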